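/- Let f₁, f₂ be functions of (x, u) ∈ ℝⁿ × ℝ^d whose gradients in u are ∇_u f₁(x, u) = (B₁ᵀP₁B₁ + R)u + B₁ᵀP₁A₁x and ∇_u f₂(x, u) = (B₂ᵀP₂B₁ + R)u + B₂ᵀP₂A₁x, where R ∈ ℝ^{d×d} and P₁, P₂ ∈ ℝ^{n×n} are positive definite, A₁ ∈ ℝ^{n×n}, B₁, B₂ ∈ ℝ^{n×d}, and B₂ᵀP₂B₁ + R is invertible with (B₂ᵀP₂B₁ + R) ⪰ σ̲(R)·I in the sense that ‖(B₂ᵀP₂B₁ + R)v‖ ≥ σ̲(R)‖v‖ for all v. Let K₁ = −(B₁ᵀP₁B₁ + R)⁻¹B₁ᵀP₁A₁ and K₂ = −(B₂ᵀP₂B₁ + R)⁻¹B₂ᵀP₂A₁ be the unique matrices with ∇_u f₁(x, K₁x) = 0 and ∇_u f₂(x, K₂x) = 0 for every x. Set Γ = 1 + max{‖A₁‖, ‖B₁‖, ‖P₁‖, ‖K₁‖}. Suppose there exist ε_B, ε_P with 0 < ε_B, ε_P < Γ such that ‖B₁ − B₂‖ ≤ ε_B and ‖P₁ − P₂‖ ≤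 ε_P. Then ‖K₁ − K₂‖ ≤ 2Γ³(ε_B + 2ε_P)/σ̲(R). -/

import Mathlib

open Matrix

/-- The operator norm of a real matrix induced by the Euclidean vector norm. -/
noncomputable def mnorm {m n : ℕ} (A : Matrix (Fin m) (Fin n) ℝ) : ℝ :=
  ‖LinearMap.toContinuousLinearMap (Matrix.toEuclideanLin A)‖

/-- The Euclidean norm of a real vector. -/
noncomputable def vnorm {n : ℕ} (x : Fin n → ℝ) : ℝ :=
  Real.sqrt (∑ i, x i ^ 2)
section aux
open scoped Matrix.Norms.L2Operator

theorem mnorm_eq {m n : ℕ} (A : Matrix (Fin m) (Fin n) ℝ) : mnorm A = ‖A‖ := by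
  rw [Matrix.l2_opNorm_def]; rfl

theorem mnorm_nonneg {m n : ℕ} (A : Matrix (Fin m) (Fin n) ℝ) : 0 ≤ mnorm A := norm_nonneg _

theorem mnorm_mul {m n k : ℕ} (A : Matrix (Fin m) (Fin n) ℝ) (B : Matrix (Fin n) (Fin k) ℝ) :
    mnorm (A * B) ≤ mnorm A * mnorm B := by
  simp only [mnorm_eq]; exact Matrix.l2_opNorm_mul A B

theorem mnorm_add {m n : ℕ} (A B : Matrix (Fin m) (Fin n) ℝ) :
    mnorm (A + B) ≤ mnorm A + mnorm B := by
  simp only [mnorm_eq]; exact norm_add_le A B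

theorem mnorm_sub_comm {m n : ℕ} (A B : Matrix (Fin m) (Fin n) ℝ) :
    mnorm (A - B) = mnorm (B - A) := by
  simp only [mnorm_eq]; exact norm_sub_rev A B

theorem mnorm_transpose {m n : ℕ} (A : Matrix (Fin m) (Fin n) ℝ) : mnorm Aᵀ = mnorm A := by
  simp only [mnorm_eq]
  rw [← Matrix.conjTranspose_eq_transpose_of_trivial]; exact Matrix.l2_opNorm_conjTranspose A

theorem vnorm_eq {n : ℕ} (x : Fin n → ℝ) : vnorm x = ‖WithLp.toLp 2 x‖ := by
  simp [vnorm, EuclideanSpace.norm_eq]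

theorem mnorm_mulVec {m n : ℕ} (A : Matrix (Fin m) (Fin n) ℝ) (x : Fin n → ℝ) :
    vnorm (A *ᵥ x) ≤ mnorm A * vnorm x := by
  simp only [vnorm_eq]
  exact (LinearMap.toContinuousLinearMap (Matrix.toEuclideanLin A)).le_opNorm (WithLp.toLp 2 x)

theorem mnorm_le {m n : ℕ} (A : Matrix (Fin m) (Fin n) ℝ) (c : ℝ) (hc : 0 ≤ c)
    (h : ∀ x, vnorm (A *ᵥ x) ≤ c * vnorm x) : mnorm A ≤ c := by
  refine ContinuousLinearMap.opNorm_le_bound _ hc fun x => ?_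
  have := h (WithLp.ofLp x)
  simp only [vnorm_eq] at this
  exact this

end aux

/-- Lemma 11 of the paper, perturbation of one-step ILC minimizers.
With `K₁ = -(B₁ᵀP₁B₁ + R)⁻¹B₁ᵀP₁A₁`, `K₂ = -(B₂ᵀP₂B₁ + R)⁻¹B₂ᵀP₂A₁`,
`Γ = 1 + max{‖A₁‖, ‖B₁‖, ‖P₁‖, ‖K₁‖}`, and perturbations `ε_B, ε_P < Γ`, we get
`‖K₁ - K₂‖ ≤ 2Γ³(ε_B + 2ε_P)/σ̲(R)`, where `σ̲(R)` is the smallest singular value of `R`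
(formalized via an arbitrary lower bound `σ`, which is also assumed to be a lower bound on
the singular values of `B₂ᵀP₂B₁ + R` as stated). -/
theorem statement9
    (n d : ℕ)
    (A₁ : Matrix (Fin n) (Fin n) ℝ) (B₁ B₂ : Matrix (Fin n) (Fin d) ℝ)
    (R : Matrix (Fin d) (Fin d) ℝ) (P₁ P₂ : Matrix (Fin n) (Fin n) ℝ)
    (hR : R.PosDef) (hP₁ : P₁.PosDef) (hP₂ : P₂.PosDef)
    (hunit : IsUnit (B₂ᵀ * P₂ * B₁ + R))
    (K₁ K₂ : Matrix (Fin d) (Fin n) ℝ)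
    (hK₁ : K₁ = -((B₁ᵀ * P₁ * B₁ + R)⁻¹ * (B₁ᵀ * P₁ * A₁)))
    (hK₂ : K₂ = -((B₂ᵀ * P₂ * B₁ + R)⁻¹ * (B₂ᵀ * P₂ * A₁)))
    (Γ : ℝ)
    (hΓ : Γ = 1 + max (max (mnorm A₁) (mnorm B₁)) (max (mnorm P₁) (mnorm K₁)))
    (εB εP : ℝ)
    (hεB0 : 0 < εB) (hεP0 : 0 < εP) (hεBΓ : εB < Γ) (hεPΓ : εP < Γ)
    (hB : mnorm (B₁ - B₂) ≤ εB) (hP : mnorm (P₁ - P₂) ≤ εP)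
    -- `σ` is a positive lower bound on the singular values of `R`,
    -- and `B₂ᵀP₂B₁ + R ⪰ σ I` in the stated sense
    (σ : ℝ) (hσ : 0 < σ)
    (hσR : ∀ v : Fin d → ℝ, σ * vnorm v ≤ vnorm (R.mulVec v))
    (hσM : ∀ v : Fin d → ℝ, σ * vnorm v ≤ vnorm ((B₂ᵀ * P₂ * B₁ + R).mulVec v)) :
    mnorm (K₁ - K₂) ≤ 2 * Γ ^ 3 * (εB + 2 * εP) / σ := by
  have hM1 : IsUnit (B₁ᵀ * P₁ * B₁ + R) := by
    have h1 : (B₁ᵀ * P₁ * B₁).PosSemidef := by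
      have := hP₁.posSemidef.conjTranspose_mul_mul_same B₁
      rwa [Matrix.conjTranspose_eq_transpose_of_trivial] at this
    exact (Matrix.PosDef.posSemidef_add h1 hR).isUnit
  have e1 : (B₁ᵀ * P₁ * B₁ + R) * K₁ = -(B₁ᵀ * P₁ * A₁) := by
    rw [hK₁, Matrix.mul_neg, Matrix.mul_nonsing_inv_cancel_left _ _
      ((Matrix.isUnit_iff_isUnit_det _).1 hM1)]
  have e2 : (B₂ᵀ * P₂ * B₁ + R) * K₂ = -(B₂ᵀ * P₂ * A₁) := by
    rw [hK₂, Matrix.mul_neg, Matrix.mul_nonsing_inv_cancel_left _ _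
      ((Matrix.isUnit_iff_isUnit_det _).1 hunit)]
  have key : (B₂ᵀ * P₂ * B₁ + R) * (K₁ - K₂)
      = ((B₂ - B₁)ᵀ * P₁ + B₂ᵀ * (P₂ - P₁)) * (B₁ * K₁ + A₁) := by
    have hD : (B₂ - B₁)ᵀ * P₁ + B₂ᵀ * (P₂ - P₁) = B₂ᵀ * P₂ - B₁ᵀ * P₁ := by
      rw [Matrix.transpose_sub, Matrix.sub_mul, Matrix.mul_sub]; abel
    have hR1 : R * K₁ = -(B₁ᵀ * P₁ * A₁) - B₁ᵀ * P₁ * B₁ * K₁ := by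
      rw [← e1, Matrix.add_mul]; abel
    rw [hD, Matrix.mul_sub, e2, Matrix.add_mul, hR1, Matrix.sub_mul, Matrix.mul_add,
      Matrix.mul_add]
    simp only [Matrix.mul_assoc]
    abel
  have hA : mnorm A₁ ≤ Γ - 1 := by
    have := (le_max_left (mnorm A₁) (mnorm B₁)).trans
      (le_max_left _ (max (mnorm P₁) (mnorm K₁)))
    linarith
  have hB1 : mnorm B₁ ≤ Γ - 1 := by
    have := (le_max_right (mnorm A₁) (mnorm B₁)).trans
      (le_max_left _ (max (mnorm P₁) (mnorm K₁)))
    linarith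
  have hP1 : mnorm P₁ ≤ Γ - 1 := by
    have := (le_max_left (mnorm P₁) (mnorm K₁)).trans
      (le_max_right (max (mnorm A₁) (mnorm B₁)) _)
    linarith
  have hK1 : mnorm K₁ ≤ Γ - 1 := by
    have := (le_max_right (mnorm P₁) (mnorm K₁)).trans
      (le_max_right (max (mnorm A₁) (mnorm B₁)) _)
    linarith
  have hΓ1 : 0 ≤ Γ - 1 := (mnorm_nonneg A₁).trans hA
  have hB2 : mnorm B₂ ≤ 2 * Γ := by
    have h := mnorm_add B₁ (B₂ - B₁)
    rw [add_sub_cancel, mnorm_sub_comm B₂ B₁] at h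
    linarith
  have hDn : mnorm ((B₂ - B₁)ᵀ * P₁ + B₂ᵀ * (P₂ - P₁)) ≤ εB * Γ + 2 * Γ * εP := by
    refine (mnorm_add _ _).trans (add_le_add ?_ ?_)
    · refine (mnorm_mul _ _).trans ?_
      rw [mnorm_transpose, mnorm_sub_comm]
      exact mul_le_mul hB (by linarith) (mnorm_nonneg _) hεB0.le
    · refine (mnorm_mul _ _).trans ?_
      rw [mnorm_transpose, mnorm_sub_comm]
      exact mul_le_mul hB2 hP (mnorm_nonneg _) (by linarith)
  have hE : mnorm (B₁ * K₁ + A₁) ≤ Γ ^ 2 := by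
    have h1 : mnorm (B₁ * K₁) ≤ (Γ - 1) * (Γ - 1) :=
      (mnorm_mul _ _).trans (mul_le_mul hB1 hK1 (mnorm_nonneg _) hΓ1)
    have := mnorm_add (B₁ * K₁) A₁
    nlinarith
  have hpos : 0 ≤ Γ ^ 3 * (εB + 2 * εP) := by
    have : 0 ≤ Γ := by linarith
    positivity
  have hT : mnorm ((B₂ᵀ * P₂ * B₁ + R) * (K₁ - K₂)) ≤ 2 * Γ ^ 3 * (εB + 2 * εP) := by
    rw [key]
    have h0 : 0 ≤ εB * Γ + 2 * Γ * εP := (mnorm_nonneg _).trans hDn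
    have := (mnorm_mul _ _).trans (mul_le_mul hDn hE (mnorm_nonneg _) h0)
    nlinarith
  refine mnorm_le _ _ (div_nonneg (by linarith) hσ.le) fun x => ?_
  have h1 := hσM ((K₁ - K₂) *ᵥ x)
  rw [Matrix.mulVec_mulVec] at h1
  have h2 := mnorm_mulVec ((B₂ᵀ * P₂ * B₁ + R) * (K₁ - K₂)) x
  have h3 := mul_le_mul_of_nonneg_right hT (show 0 ≤ vnorm x from Real.sqrt_nonneg _)
  rw [div_mul_eq_mul_div, le_div_iff₀ hσ]
  linarith
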